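/- Assume 0 ≤ v(c) < p/((q+1)(p−1)). Then L_c(X) has q² distinct roots in Ω; for every root y of L_c one has v(L_c′(y)) = v(a_n) = p(q−1)/(p−1), where L_c′ is the derivative of L_c; and any two distinct roots y ≠ y′ of L_c satisfy v(y − y′) = p/((q+1)(p−1)) (= v(λ^{p/(1+q)})). -/

import Mathlib

open Polynomial

noncomputable section

/-- `K₀`: the fraction field of the Witt vectors over `𝔽̄_p`, i.e. the completion of `ℚ_p^ur`. -/
abbrev Kzero (p : ℕ) [Fact p.Prime] : Type :=
  FractionRing (WittVector p (AlgebraicClosure (ZMod p)))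

/-- `Ω`: a fixed algebraic closure of `K₀`. -/
abbrev Omg (p : ℕ) [Fact p.Prime] : Type := AlgebraicClosure (Kzero p)

/-- `a_n = (-1)^q · (-p)^(p + p² + ⋯ + pⁿ)` as an element of a commutative ring. -/
def aCoef (R : Type) [CommRing R] (p n : ℕ) : R :=
  (-1) ^ p ^ n * (-(p : R)) ^ (Finset.sum (Finset.range n) fun i => p ^ (i + 1))

/-- `f_{q,c}(X) = 1 + c·X^q + X^(1+q)` with `q = pⁿ`. -/
def fqc (R : Type) [CommRing R] (p n : ℕ) (c : R) : Polynomial R :=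
  1 + C c * X ^ p ^ n + X ^ (p ^ n + 1)

/-- The modified monodromy polynomial `L_c(X) = X^(q²) − a_n·(c+X)·f_{q,c}(X)^(q−1)`. -/
def Lpoly (R : Type) [CommRing R] (p n : ℕ) (c : R) : Polynomial R :=
  X ^ (p ^ n * p ^ n) - C (aCoef R p n) * (C c + X) * fqc R p n c ^ (p ^ n - 1)

set_option maxHeartbeats 1000000

/-- A function on a field satisfying the laws of a rational-valued additive valuation away from
`0`, where its value is unconstrained. -/
structure IsRatValuation {K : Type} [Field K] (v : K → ℚ) : Prop where
  map_mul : ∀ x y : K, x ≠ 0 → y ≠ 0 → v (x * y) = v x + v y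
  map_add : ∀ x y : K, x ≠ 0 → y ≠ 0 → x + y ≠ 0 → min (v x) (v y) ≤ v (x + y)

/-- `x` has valuation at least `r`, with the convention that `0` has infinite valuation. -/
def AtLeast {K : Type} [Field K] (v : K → ℚ) (r : ℚ) (x : K) : Prop := x = 0 ∨ r ≤ v x

section Valuation

variable {K : Type} [Field K] {v : K → ℚ} {r s t : ℚ} {x y : K}

lemma AtLeast.mono (h : AtLeast v r x) (hs : s ≤ r) : AtLeast v s x :=
  h.imp_right hs.trans

lemma AtLeast.le (h : AtLeast v r x) (hx : x ≠ 0) : r ≤ v x := h.resolve_left hx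

lemma atLeast_self : AtLeast v (v x) x := Or.inr le_rfl

namespace IsRatValuation

lemma map_one (hv : IsRatValuation v) : v 1 = 0 := by
  have := hv.map_mul 1 1 one_ne_zero one_ne_zero
  rw [mul_one] at this
  linarith

lemma map_neg_one (hv : IsRatValuation v) : v (-1) = 0 := by
  have h := hv.map_mul (-1) (-1) (by simp) (by simp)
  rw [neg_mul_neg, mul_one, hv.map_one] at h
  linarith

lemma map_neg (hv : IsRatValuation v) (x : K) : v (-x) = v x := by
  rcases eq_or_ne x 0 with rfl | hx
  · rw [neg_zero]
  · rw [← neg_one_mul, hv.map_mul _ _ (by simp) hx, hv.map_neg_one, zero_add]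

lemma map_pow (hv : IsRatValuation v) (hx : x ≠ 0) (m : ℕ) : v (x ^ m) = m * v x := by
  induction m with
  | zero => simp [hv.map_one]
  | succ m ih =>
    rw [pow_succ, hv.map_mul _ _ (pow_ne_zero _ hx) hx, ih]
    push_cast
    ring

lemma atLeast_add (hv : IsRatValuation v) (hx : AtLeast v r x) (hy : AtLeast v r y) :
    AtLeast v r (x + y) := by
  by_cases h0 : x + y = 0
  · exact Or.inl h0
  by_cases hx0 : x = 0
  · simpa [hx0] using hy
  by_cases hy0 : y = 0
  · simpa [hy0] using hx
  exact Or.inr ((le_min (hx.le hx0) (hy.le hy0)).trans (hv.map_add x y hx0 hy0 h0))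

lemma atLeast_neg (hv : IsRatValuation v) (hx : AtLeast v r x) : AtLeast v r (-x) :=
  hx.imp neg_eq_zero.2 fun h => by rwa [hv.map_neg]

lemma atLeast_sub (hv : IsRatValuation v) (hx : AtLeast v r x) (hy : AtLeast v r y) :
    AtLeast v r (x - y) := by
  rw [sub_eq_add_neg]
  exact hv.atLeast_add hx (hv.atLeast_neg hy)

lemma atLeast_mul (hv : IsRatValuation v) (hx : AtLeast v r x) (hy : AtLeast v s y) :
    AtLeast v (r + s) (x * y) := by
  by_cases hx0 : x = 0
  · exact Or.inl (by simp [hx0])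
  by_cases hy0 : y = 0
  · exact Or.inl (by simp [hy0])
  refine Or.inr ?_
  rw [hv.map_mul x y hx0 hy0]
  exact add_le_add (hx.le hx0) (hy.le hy0)

lemma atLeast_one (hv : IsRatValuation v) : AtLeast v 0 1 := Or.inr hv.map_one.ge

lemma atLeast_pow (hv : IsRatValuation v) (hx : AtLeast v r x) (m : ℕ) :
    AtLeast v (m * r) (x ^ m) := by
  induction m with
  | zero => simpa using hv.atLeast_one
  | succ m ih =>
    rw [pow_succ]
    exact (hv.atLeast_mul ih hx).mono (by push_cast; linarith)

lemma atLeast_pow_zero (hv : IsRatValuation v) (hx : AtLeast v 0 x) (m : ℕ) :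
    AtLeast v 0 (x ^ m) := by
  simpa using hv.atLeast_pow hx m

lemma atLeast_natCast (hv : IsRatValuation v) (m : ℕ) : AtLeast v 0 (m : K) := by
  induction m with
  | zero => exact Or.inl (by simp)
  | succ m ih =>
    rw [Nat.cast_succ]
    exact hv.atLeast_add ih hv.atLeast_one

lemma atLeast_sum (hv : IsRatValuation v) {ι : Type} (S : Finset ι) (g : ι → K)
    (h : ∀ i ∈ S, AtLeast v r (g i)) :
    AtLeast v r (∑ i ∈ S, g i) :=
  Finset.sum_induction g (AtLeast v r) (fun _ _ => hv.atLeast_add) (Or.inl rfl) h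

lemma add_eq_of_lt (hv : IsRatValuation v) (hx : x ≠ 0) (hy : AtLeast v s y) (hs : v x < s) :
    x + y ≠ 0 ∧ v (x + y) = v x := by
  have h0 : x + y ≠ 0 := by
    intro h
    have hy0 : y = -x := by linear_combination h
    have := hy.le (by simpa [hy0] using hx)
    rw [hy0, hv.map_neg] at this
    linarith
  refine ⟨h0, le_antisymm ?_ ?_⟩
  · by_contra! hlt
    have hy' : AtLeast v (min s (v (x + y))) x := by
      have := hv.atLeast_sub (atLeast_self.mono (min_le_right s _))
        (hy.mono (min_le_left _ (v (x + y))))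
      simpa using this
    exact absurd (hy'.le hx) (not_le.2 (lt_min hs hlt))
  · exact (hv.atLeast_add atLeast_self (hy.mono hs.le)).le h0

lemma atLeast_pow_succ_sub (hv : IsRatValuation v) (hxy : AtLeast v s (x - y)) (hx : AtLeast v t x)
    (hy : AtLeast v t y) (k : ℕ) : AtLeast v (s + k * t) (x ^ (k + 1) - y ^ (k + 1)) := by
  induction k with
  | zero => simpa using hxy
  | succ k ih =>
    have e : x ^ (k + 1 + 1) - y ^ (k + 1 + 1)
        = x * (x ^ (k + 1) - y ^ (k + 1)) + (x - y) * y ^ (k + 1) := by ring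
    rw [e]
    exact hv.atLeast_add ((hv.atLeast_mul hx ih).mono (by push_cast; linarith))
      (hv.atLeast_mul hxy (hv.atLeast_pow hy _))

end IsRatValuation

end Valuation

lemma lt_one_add_sq_sub_one_mul {q : ℕ} {a c t : ℚ} (hq : 2 ≤ q) (hc : 0 ≤ c)
    (haq : a < (q : ℚ) ^ 2) (ht : (q : ℚ) ^ 2 * t = a + c) : a < 1 + ((q : ℚ) ^ 2 - 1) * t := by
  have hq' : (1 : ℚ) ≤ (q : ℚ) ^ 2 := one_le_pow₀ (by exact_mod_cast (by omega : 1 ≤ q))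
  have : t < 1 + c := by
    by_contra! hle
    nlinarith [mul_le_mul_of_nonneg_left hle (sq_nonneg (q : ℚ)),
      mul_nonneg hc (sub_nonneg.2 hq')]
  linarith

section Roots

variable {K : Type} [Field K] {v : K → ℚ} {q : ℕ} {a c y y' : K}

lemma map_trinomial_of_pos (hv : IsRatValuation v) (hq : 2 ≤ q) (hc : 0 ≤ v c) (hy : 0 < v y) :
    1 + c * y ^ q + y ^ (q + 1) ≠ 0 ∧ v (1 + c * y ^ q + y ^ (q + 1)) = 0 := by
  have hq' : (2 : ℚ) ≤ q := by exact_mod_cast hq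
  have h : AtLeast v (v y) (c * y ^ q + y ^ (q + 1)) := by
    refine hv.atLeast_add ?_ ?_
    · exact (hv.atLeast_mul atLeast_self (hv.atLeast_pow atLeast_self q)).mono (by nlinarith)
    · exact (hv.atLeast_pow atLeast_self (q + 1)).mono (by push_cast; nlinarith)
  have := hv.add_eq_of_lt one_ne_zero h (by rwa [hv.map_one])
  rwa [hv.map_one, ← add_assoc] at this

lemma root_ne_zero_and_map (hv : IsRatValuation v) (hq : 2 ≤ q) (ha : a ≠ 0) (hc : c ≠ 0)
    (hc0 : 0 ≤ v c)
    (hapos : 0 < v a) (hca : ((q : ℚ) ^ 2 - 1) * v c < v a)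
    (hy : y ^ (q * q) = a * (c + y) * (1 + c * y ^ q + y ^ (q + 1)) ^ (q - 1)) :
    y ≠ 0 ∧ 0 < v y ∧ (q : ℚ) ^ 2 * v y = v a + v c := by
  have hq' : (2 : ℚ) ≤ q := by exact_mod_cast hq
  have hq1 : ((q - 1 : ℕ) : ℚ) = q - 1 := by rw [Nat.cast_sub (by omega)]; simp
  have hy0 : y ≠ 0 := by
    rintro rfl
    have hq0 : q ≠ 0 := by omega
    simp [hq0, ha, hc] at hy
  have hne := pow_ne_zero (q * q) hy0
  have hval := hv.map_pow hy0 (q * q)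
  rw [hy] at hne
  have hcy : c + y ≠ 0 := right_ne_zero_of_mul (left_ne_zero_of_mul hne)
  have hf : 1 + c * y ^ q + y ^ (q + 1) ≠ 0 := by
    intro h
    rw [h, zero_pow (by omega), mul_zero] at hne
    exact hne rfl
  rw [hy, hv.map_mul _ _ (mul_ne_zero ha hcy) (pow_ne_zero _ hf), hv.map_mul _ _ ha hcy,
    hv.map_pow hf, hq1] at hval
  push_cast at hval
  have hpos : 0 < v y := by
    rcases lt_or_ge (v y) 0 with hneg | hnn
    · exfalso
      have h1 : v (c + y) = v y := by
        rw [add_comm]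
        exact (hv.add_eq_of_lt hy0 (atLeast_self (x := c)) (by linarith)).2
      have h2 : AtLeast v (q * v y) (1 + c * y ^ q) :=
        hv.atLeast_add (hv.atLeast_one.mono (by nlinarith))
          ((hv.atLeast_mul atLeast_self (hv.atLeast_pow atLeast_self q)).mono (by linarith))
      have h3 := (hv.add_eq_of_lt (pow_ne_zero (q + 1) hy0) h2
        (by rw [hv.map_pow hy0]; push_cast; linarith)).2
      rw [add_comm, hv.map_pow hy0] at h3
      rw [h1, h3] at hval
      push_cast at hval
      nlinarith
    · have hy1 : AtLeast v 0 y := Or.inr hnn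
      have hc1 : AtLeast v 0 c := Or.inr hc0
      have h1 := (hv.atLeast_add hc1 hy1).le hcy
      have h2 : AtLeast v 0 (1 + c * y ^ q + y ^ (q + 1)) :=
        hv.atLeast_add (hv.atLeast_add hv.atLeast_one
          ((hv.atLeast_mul hc1 (hv.atLeast_pow_zero hy1 q)).mono (by simp)))
          (hv.atLeast_pow_zero hy1 _)
      have h3 := h2.le hf
      by_contra hle
      have : v y = 0 := by linarith
      rw [this] at hval
      nlinarith
  rw [(map_trinomial_of_pos hv hq hc0 hpos).2] at hval
  have hlt : v c < v y := by
    by_contra! hle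
    have := (hv.atLeast_add (atLeast_self.mono hle) atLeast_self).le hcy
    nlinarith
  rw [(hv.add_eq_of_lt hc atLeast_self hlt).2] at hval
  exact ⟨hy0, hpos, by linarith⟩

lemma map_derivative_at_root (hv : IsRatValuation v) (hq : 2 ≤ q) {N : K} (hN : AtLeast v 1 N)
    (ha : a ≠ 0) (hc0 : 0 ≤ v c)
    (haq : v a < (q : ℚ) ^ 2) (hpos : 0 < v y)
    (hvy : (q : ℚ) ^ 2 * v y = v a + v c) :
    let f := 1 + c * y ^ q + y ^ (q + 1)
    let d := N * y ^ (q * q - 1) - a * (f ^ (q - 1) + (c + y) * ((q - 1 : ℕ) * f ^ (q - 1 - 1) *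
      (c * (q * y ^ (q - 1)) + (q + 1 : ℕ) * y ^ q)))
    d ≠ 0 ∧ v d = v a := by
  intro f d
  have hq' : (2 : ℚ) ≤ q := by exact_mod_cast hq
  have hqq : ((q * q - 1 : ℕ) : ℚ) = (q : ℚ) ^ 2 - 1 := by
    rw [Nat.cast_sub (by nlinarith)]; push_cast; ring
  obtain ⟨hf, hvf⟩ := map_trinomial_of_pos hv hq hc0 hpos
  have hmain : v (-(a * f ^ (q - 1))) = v a := by
    rw [hv.map_neg, hv.map_mul _ _ ha (pow_ne_zero _ hf), hv.map_pow hf, hvf]; ring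
  have hf0 : AtLeast v 0 f := Or.inr hvf.ge
  have hy1 : AtLeast v 0 y := Or.inr hpos.le
  have hc1 : AtLeast v 0 c := Or.inr hc0
  have hyt : ∀ m : ℕ, 1 ≤ m → AtLeast v (v y) (y ^ m) := fun m hm => by
    have : (1 : ℚ) ≤ m := by exact_mod_cast hm
    exact (hv.atLeast_pow atLeast_self m).mono (by nlinarith)
  have hfd : AtLeast v (v y) (c * (q * y ^ (q - 1)) + (q + 1 : ℕ) * y ^ q) :=
    hv.atLeast_add
      ((hv.atLeast_mul hc1 (hv.atLeast_mul (hv.atLeast_natCast q) (hyt (q - 1) (by omega)))).mono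
        (by linarith))
      ((hv.atLeast_mul (hv.atLeast_natCast (q + 1)) (hyt q (by omega))).mono (by linarith))
  have h2 : AtLeast v (v a + v y) (a * ((c + y) * ((q - 1 : ℕ) * f ^ (q - 1 - 1) *
      (c * (q * y ^ (q - 1)) + (q + 1 : ℕ) * y ^ q)))) :=
    (hv.atLeast_mul atLeast_self (hv.atLeast_mul (hv.atLeast_add hc1 hy1)
      (hv.atLeast_mul (hv.atLeast_mul (hv.atLeast_natCast (q - 1))
        (hv.atLeast_pow_zero hf0 _)) hfd))).mono (by linarith)
  have h1 : AtLeast v (1 + ((q : ℚ) ^ 2 - 1) * v y) (N * y ^ (q * q - 1)) :=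
    (hv.atLeast_mul hN (hv.atLeast_pow atLeast_self _)).mono (by rw [hqq])
  have hlt := lt_one_add_sq_sub_one_mul hq hc0 haq hvy
  have key := hv.add_eq_of_lt (neg_ne_zero.2 (mul_ne_zero ha (pow_ne_zero _ hf)))
    (hv.atLeast_sub (h1.mono (min_le_left _ (v a + v y))) (h2.mono (min_le_right _ _)))
    (by rw [hmain]; exact lt_min hlt (by linarith))
  rw [hmain] at key
  have e : d = -(a * f ^ (q - 1)) + (N * y ^ (q * q - 1) - a * ((c + y) * ((q - 1 : ℕ) *
      f ^ (q - 1 - 1) * (c * (q * y ^ (q - 1)) + (q + 1 : ℕ) * y ^ q)))) := by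
    simp only [d]; ring
  rwa [e]

lemma map_sub_of_roots (hv : IsRatValuation v) (hq : 2 ≤ q) {p m : ℕ} (hp : p.Prime)
    (hqp : q * q = p ^ m) (hvp : AtLeast v 1 (p : K))
    (ha : a ≠ 0) (hc0 : 0 ≤ v c) (haq : v a < (q : ℚ) ^ 2)
    (hpos : 0 < v y) (hvy : (q : ℚ) ^ 2 * v y = v a + v c) (hvy' : v y' = v y)
    (hy : y ^ (q * q) = a * (c + y) * (1 + c * y ^ q + y ^ (q + 1)) ^ (q - 1))
    (hy' : y' ^ (q * q) = a * (c + y') * (1 + c * y' ^ q + y' ^ (q + 1)) ^ (q - 1))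
    (hne : y' - y ≠ 0) :
    ((q : ℚ) ^ 2 - 1) * v (y' - y) = v a := by
  have hq' : (2 : ℚ) ≤ q := by exact_mod_cast hq
  obtain ⟨hf, hvf⟩ := map_trinomial_of_pos hv hq hc0 hpos
  obtain ⟨hf', hvf'⟩ := map_trinomial_of_pos (y := y') hv hq hc0 (hvy'.symm ▸ hpos)
  set f := 1 + c * y ^ q + y ^ (q + 1) with hfdef
  set f' := 1 + c * y' ^ q + y' ^ (q + 1) with hfdef'
  set z := y' - y with hz
  have hyt : AtLeast v (v y) y := atLeast_self
  have hyt' : AtLeast v (v y) y' := Or.inr hvy'.ge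
  have hc1 : AtLeast v 0 c := Or.inr hc0
  have hzt : v y ≤ v z := (hv.atLeast_sub hyt' hyt).le hne
  have hpow : ∀ k : ℕ, 1 ≤ k → AtLeast v (v z + v y) (y' ^ (k + 1) - y ^ (k + 1)) := by
    intro k hk
    have : (1 : ℚ) ≤ k := by exact_mod_cast hk
    exact (hv.atLeast_pow_succ_sub (atLeast_self (x := y' - y)) hyt' hyt k).mono (by nlinarith)
  have hfsub : AtLeast v (v z + v y) (f' - f) := by
    have e : f' - f = c * (y' ^ (q - 1 + 1) - y ^ (q - 1 + 1)) + (y' ^ (q + 1) - y ^ (q + 1)) := by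
      rw [Nat.sub_add_cancel (by omega), hfdef, hfdef']; ring
    rw [e]
    exact hv.atLeast_add ((hv.atLeast_mul hc1 (hpow (q - 1) (by omega))).mono (by linarith))
      (hpow q (by omega))
  have hfpow : AtLeast v (v z + v y) (f' ^ (q - 1) - f ^ (q - 1)) := by
    have := hv.atLeast_pow_succ_sub hfsub (Or.inr hvf'.ge) (Or.inr hvf.ge) (q - 2)
    rwa [show q - 2 + 1 = q - 1 by omega, mul_zero, add_zero] at this
  have hmain : v (a * z * f' ^ (q - 1)) = v a + v z := by
    rw [hv.map_mul _ _ (mul_ne_zero ha hne) (pow_ne_zero _ hf'), hv.map_pow hf', hvf',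
      hv.map_mul _ _ ha hne]
    ring
  have h1 : AtLeast v (v a + (v z + v y)) (a * ((c + y) * (f' ^ (q - 1) - f ^ (q - 1)))) :=
    (hv.atLeast_mul atLeast_self (hv.atLeast_mul
      (hv.atLeast_add hc1 (hyt.mono hpos.le)) hfpow)).mono (by linarith)
  have h2 : AtLeast v (1 + (v z + ((q : ℚ) ^ 2 - 1) * v y))
      (p * z * y * ∑ k ∈ Finset.Ioo 0 (p ^ m),
        z ^ (k - 1) * y ^ (p ^ m - k - 1) * ((p ^ m).choose k / p : ℕ)) := by
    refine (hv.atLeast_mul (hv.atLeast_mul (hv.atLeast_mul hvp (atLeast_self (x := z))) hyt)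
      (hv.atLeast_sum (r := ((q : ℚ) ^ 2 - 2) * v y) _ _ fun k hk => ?_)).mono (by linarith)
    rw [Finset.mem_Ioo] at hk
    have hk1 : ((k - 1 : ℕ) : ℚ) = k - 1 := by rw [Nat.cast_sub (by omega)]; simp
    have hk0 : (0 : ℚ) ≤ k - 1 := hk1 ▸ Nat.cast_nonneg _
    have hk2 : ((p ^ m - k - 1 : ℕ) : ℚ) = (q : ℚ) ^ 2 - k - 1 := by
      rw [Nat.cast_sub (by omega), Nat.cast_sub hk.2.le, ← hqp]; push_cast; ring
    refine (hv.atLeast_mul (hv.atLeast_mul (hv.atLeast_pow (atLeast_self (x := z)) (k - 1))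
      (hv.atLeast_pow hyt (p ^ m - k - 1))) (hv.atLeast_natCast _)).mono ?_
    rw [hk1, hk2]
    nlinarith
  have hlt := lt_one_add_sq_sub_one_mul hq hc0 haq hvy
  have key := (hv.add_eq_of_lt (mul_ne_zero (mul_ne_zero ha hne) (pow_ne_zero (q - 1) hf'))
    (hv.atLeast_sub (h1.mono (min_le_left _ (1 + (v z + ((q : ℚ) ^ 2 - 1) * v y))))
      (h2.mono (min_le_right _ _)))
    (by rw [hmain]; exact lt_min (by linarith) (by linarith))).2
  have hexp := add_pow_prime_pow_eq hp z y m
  have e : a * z * f' ^ (q - 1) + (a * ((c + y) * (f' ^ (q - 1) - f ^ (q - 1))) -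
      p * z * y * ∑ k ∈ Finset.Ioo 0 (p ^ m),
        z ^ (k - 1) * y ^ (p ^ m - k - 1) * ((p ^ m).choose k / p : ℕ))
      = z ^ (q * q) := by
    rw [show z + y = y' by rw [hz]; ring, ← hqp, hy, hy'] at hexp
    rw [← hqp]
    linear_combination hexp + (a * f' ^ (q - 1)) * hz
  rw [e, hmain, hv.map_pow hne] at key
  push_cast at key
  linarith

end Roots

section Lpoly

variable {K : Type} [Field K] {p n : ℕ} {c : K}

lemma isRoot_Lpoly_iff {y : K} : (Lpoly K p n c).IsRoot y ↔
    y ^ (p ^ n * p ^ n) = aCoef K p n * (c + y) *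
      (1 + c * y ^ p ^ n + y ^ (p ^ n + 1)) ^ (p ^ n - 1) := by
  simp [Lpoly, fqc, IsRoot.def, sub_eq_zero]

lemma eval_derivative_Lpoly (y : K) : (derivative (Lpoly K p n c)).eval y =
    ((p ^ n * p ^ n : ℕ) : K) * y ^ (p ^ n * p ^ n - 1) - aCoef K p n *
      ((1 + c * y ^ p ^ n + y ^ (p ^ n + 1)) ^ (p ^ n - 1) + (c + y) *
        (((p ^ n - 1 : ℕ) : K) * (1 + c * y ^ p ^ n + y ^ (p ^ n + 1)) ^ (p ^ n - 1 - 1) *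
          (c * ((p ^ n : ℕ) * y ^ (p ^ n - 1)) + ((p ^ n + 1 : ℕ) : K) * y ^ p ^ n))) := by
  simp only [Lpoly, fqc, derivative_sub, derivative_mul, derivative_C, derivative_add,
    derivative_X, derivative_one, derivative_pow, eval_sub, eval_mul, eval_add,
    eval_pow, eval_C, eval_X, eval_one, eval_zero, Nat.add_sub_cancel]
  ring

lemma natDegree_Lpoly (hp : 0 < p) (ha : aCoef K p n ≠ 1) :
    (Lpoly K p n c).natDegree = p ^ n * p ^ n := by
  have hq : 0 < p ^ n := pow_pos hp n
  have hf : (fqc K p n c).natDegree ≤ p ^ n + 1 := by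
    unfold fqc; compute_degree!
  have hfc : (fqc K p n c).coeff (p ^ n + 1) = 1 := by
    simp [fqc, coeff_one, coeff_X_pow]
  have he : p ^ n * p ^ n = 1 + (p ^ n - 1) * (p ^ n + 1) := by
    obtain ⟨r, hr⟩ : ∃ r, p ^ n = r + 1 := ⟨p ^ n - 1, by omega⟩
    rw [hr, Nat.add_sub_cancel]; ring
  have hl : (C (aCoef K p n) * (C c + X)).natDegree ≤ 1 := by compute_degree!
  have hle := natDegree_pow_le_of_le (p ^ n - 1) hf
  refine natDegree_eq_of_le_of_coeff_ne_zero ?_ ?_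
  · unfold Lpoly
    refine (natDegree_sub_le _ _).trans (max_le (natDegree_X_pow_le _) ?_)
    exact (natDegree_mul_le_of_le hl hle).trans he.ge
  · have h : (C (aCoef K p n) * (C c + X) * fqc K p n c ^ (p ^ n - 1)).coeff (p ^ n * p ^ n)
        = aCoef K p n := by
      rw [he, coeff_mul_add_eq_of_natDegree_le hl hle, coeff_pow_of_natDegree_le hf, hfc]
      simp [coeff_X]
    rw [Lpoly, coeff_sub, coeff_X_pow_self, h]
    exact sub_ne_zero.2 ha.symm

end Lpoly

lemma map_aCoef {K : Type} [Field K] {v : K → ℚ} (hv : IsRatValuation v) {p : ℕ}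
    (hp1 : 2 ≤ p) (hp : (p : K) ≠ 0) (hvp : v p = 1) (n : ℕ) :
    aCoef K p n ≠ 0 ∧ v (aCoef K p n) = (p : ℚ) * ((p : ℚ) ^ n - 1) / ((p : ℚ) - 1) := by
  have h1 : (-1 : K) ≠ 0 := by simp
  have h2 : (-(p : K)) ≠ 0 := neg_ne_zero.2 hp
  have hp' : (p : ℚ) ≠ 1 := by exact_mod_cast (show p ≠ 1 by omega)
  refine ⟨mul_ne_zero (pow_ne_zero _ h1) (pow_ne_zero _ h2), ?_⟩
  rw [aCoef, hv.map_mul _ _ (pow_ne_zero _ h1) (pow_ne_zero _ h2), hv.map_pow h1, hv.map_pow h2,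
    hv.map_neg, hv.map_neg, hv.map_one, hvp]
  push_cast
  simp_rw [pow_succ]
  rw [← Finset.sum_mul, geom_sum_eq hp']
  ring

/-- `L_c` has `q²` distinct roots; `v(L_c′(y)) = v(a_n) = p(q−1)/(p−1)` for every
root `y`; and `v(y − y′) = p/((q+1)(p−1))` for any two distinct roots `y ≠ y′`. -/
theorem stmt_7 (p n : ℕ) [Fact p.Prime] (hn : 1 ≤ n)
    (v : Omg p → ℚ)
    (hv_mul : ∀ x y : Omg p, x ≠ 0 → y ≠ 0 → v (x * y) = v x + v y)
    (hv_add : ∀ x y : Omg p, x ≠ 0 → y ≠ 0 → x + y ≠ 0 → min (v x) (v y) ≤ v (x + y))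
    (hv_p : v ((p : ℕ) : Omg p) = 1)
    (hv_W : ∀ x : WittVector p (AlgebraicClosure (ZMod p)), x ≠ 0 →
      0 ≤ v (algebraMap (Kzero p) (Omg p)
        (algebraMap (WittVector p (AlgebraicClosure (ZMod p))) (Kzero p) x)))
    (c : Omg p) (hc0 : c ≠ 0) (hc_nonneg : 0 ≤ v c)
    (hc_lt : v c < (p : ℚ) / (((p : ℚ) ^ n + 1) * ((p : ℚ) - 1))) :
    (Lpoly (Omg p) p n c).roots.Nodup ∧
    Multiset.card (Lpoly (Omg p) p n c).roots = p ^ n * p ^ n ∧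
    (∀ y : Omg p, (Lpoly (Omg p) p n c).IsRoot y →
      v ((Polynomial.derivative (Lpoly (Omg p) p n c)).eval y) =
        (p : ℚ) * ((p : ℚ) ^ n - 1) / ((p : ℚ) - 1)) ∧
    ∀ y y' : Omg p, (Lpoly (Omg p) p n c).IsRoot y → (Lpoly (Omg p) p n c).IsRoot y' →
      y ≠ y' → v (y - y') = (p : ℚ) / (((p : ℚ) ^ n + 1) * ((p : ℚ) - 1)) := by
  have hp : p.Prime := Fact.out
  have hv : IsRatValuation v := ⟨hv_mul, hv_add⟩
  have hp0 : ((p : ℕ) : Omg p) ≠ 0 := by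
    have h := (algebraMap (Kzero p) (Omg p)).injective.ne
      (WittVector.FractionRing.p_nonzero p (AlgebraicClosure (ZMod p)))
    simpa only [map_natCast, map_zero] using h
  obtain ⟨ha, hva⟩ := map_aCoef hv hp.two_le hp0 hv_p n
  have hq : 2 ≤ p ^ n := hp.two_le.trans (Nat.le_self_pow (by omega) p)
  have hp2 : (2 : ℚ) ≤ p := by exact_mod_cast hp.two_le
  have hq2 : (2 : ℚ) ≤ (p : ℚ) ^ n := by exact_mod_cast hq
  have hp1 : (0 : ℚ) < p - 1 := by linarith
  have hμ : (((p ^ n : ℕ) : ℚ) ^ 2 - 1) * ((p : ℚ) / (((p : ℚ) ^ n + 1) * ((p : ℚ) - 1)))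
      = v (aCoef (Omg p) p n) := by
    rw [hva]
    push_cast
    field_simp
    ring
  have hN : (0 : ℚ) < ((p ^ n : ℕ) : ℚ) ^ 2 - 1 := by push_cast; nlinarith
  have hapos : 0 < v (aCoef (Omg p) p n) := by
    rw [← hμ]
    exact mul_pos hN (lt_of_le_of_lt hc_nonneg hc_lt)
  have haq : v (aCoef (Omg p) p n) < ((p ^ n : ℕ) : ℚ) ^ 2 := by
    rw [hva, div_lt_iff₀ hp1]
    push_cast
    nlinarith [mul_nonneg (sub_nonneg.2 hp2) (sq_nonneg ((p : ℚ) ^ n - 1)),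
      sq_nonneg ((p : ℚ) ^ n - 1)]
  have hca : (((p ^ n : ℕ) : ℚ) ^ 2 - 1) * v c < v (aCoef (Omg p) p n) := by
    rw [← hμ]
    exact mul_lt_mul_of_pos_left hc_lt hN
  have hroot := fun (y : Omg p) (hy : (Lpoly (Omg p) p n c).IsRoot y) =>
    root_ne_zero_and_map hv hq ha hc0 hc_nonneg hapos hca (isRoot_Lpoly_iff.1 hy)
  have hvp : AtLeast v 1 (p : Omg p) := Or.inr hv_p.ge
  have hNat : AtLeast v 1 ((p ^ n * p ^ n : ℕ) : Omg p) := by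
    obtain ⟨m, hm⟩ : p ∣ p ^ n * p ^ n := (dvd_pow_self p (by omega)).mul_right _
    rw [hm, Nat.cast_mul]
    exact (hv.atLeast_mul hvp (hv.atLeast_natCast m)).mono (by norm_num)
  have hder : ∀ y : Omg p, (Lpoly (Omg p) p n c).IsRoot y →
      (derivative (Lpoly (Omg p) p n c)).eval y ≠ 0 ∧
        v ((derivative (Lpoly (Omg p) p n c)).eval y) = v (aCoef (Omg p) p n) := by
    intro y hy
    obtain ⟨-, hpos, hvy⟩ := hroot y hy
    rw [eval_derivative_Lpoly]
    exact map_derivative_at_root hv hq hNat ha hc_nonneg haq hpos hvy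
  have hdeg : (Lpoly (Omg p) p n c).natDegree = p ^ n * p ^ n := by
    refine natDegree_Lpoly hp.pos fun h => ?_
    rw [h, hv.map_one] at hapos
    exact hapos.false
  have hL0 : Lpoly (Omg p) p n c ≠ 0 := by
    intro h
    rw [h, natDegree_zero] at hdeg
    exact absurd hdeg.symm (by positivity)
  refine ⟨?_, ?_, fun y hy => (hder y hy).2.trans hva, fun y y' hy hy' hne => ?_⟩
  · classical
    rw [Multiset.nodup_iff_count_le_one]
    intro y
    rw [count_roots]
    by_contra! hlt
    obtain ⟨hr, hd⟩ := (one_lt_rootMultiplicity_iff_isRoot hL0).1 hlt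
    exact (hder y hr).1 hd
  · rw [← hdeg]
    exact (IsAlgClosed.splits _).natDegree_eq_card_roots.symm
  · obtain ⟨-, hpos, hvy⟩ := hroot y hy
    obtain ⟨-, hpos', hvy'⟩ := hroot y' hy'
    have h := map_sub_of_roots hv hq hp (m := n + n) (pow_add p n n).symm hvp ha hc_nonneg haq
      hpos' hvy' (mul_left_cancel₀ (by positivity) (hvy.trans hvy'.symm))
      (isRoot_Lpoly_iff.1 hy') (isRoot_Lpoly_iff.1 hy) (sub_ne_zero.2 hne)
    exact mul_left_cancel₀ hN.ne' (h.trans hμ.symm)
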